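/- Let u : Δ^{S_n}_{(1)} → U(n) be an admissible map. Then u extends to an admissible map on the 2-skeleton Δ^{S_n}_{(2)} if and only if for every 2-face g_0 < g_1 < g_2 of Δ^{S_n} and every block B ∈ 𝒫(Δ^{g_0,g_1,g_2}), one has w_B(γ^{g_0,g_1}) + w_B(γ^{g_1,g_2}) − w_B(γ^{g_0,g_2}) = 0, where each edge path γ^{g_i,g_j} is regarded as a path in U(𝒫(Δ^{g_0,g_1,g_2})). -/

import Mathlib

/-- The permutation matrix `U_g`, with `U_g e_i = e_{g i}`. -/
def permMat {n : ℕ} (g : Equiv.Perm (Fin n)) : Matrix (Fin n) (Fin n) ℂ :=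
  Matrix.of fun i j => if i = g j then 1 else 0

/-- `i` and `j` lie in the same orbit of the subgroup `G` of `S_n`. -/
def sameOrbit {n : ℕ} (G : Subgroup (Equiv.Perm (Fin n))) (i j : Fin n) : Prop :=
  ∃ p ∈ G, p i = j

/-- The subgroup of `S_n` generated by the differences `g⁻¹ * h` of elements of `S`;
for `S = {g₀, …, g_l}` it is the subgroup generated by `g₀⁻¹g₁, …, g₀⁻¹g_l`. -/
def groupOf {n : ℕ} (S : Finset (Equiv.Perm (Fin n))) : Subgroup (Equiv.Perm (Fin n)) :=
  Subgroup.closure {q | ∃ g ∈ S, ∃ h ∈ S, q = g⁻¹ * h}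

/-- The `k`-skeleton `Δ^{S_n}_{(k)}` of the simplex with vertices indexed by `S_n`:
points of the simplex with at most `k+1` nonzero coordinates. -/
def skel (n k : ℕ) : Set (Equiv.Perm (Fin n) → ℝ) :=
  {x | (∀ g, 0 ≤ x g) ∧ (∑ g, x g) = 1 ∧
    (Finset.univ.filter fun g => x g ≠ 0).card ≤ k + 1}

/-- The vertex of the simplex corresponding to `g ∈ S_n`. -/
def vertex {n : ℕ} (g : Equiv.Perm (Fin n)) : Equiv.Perm (Fin n) → ℝ :=
  fun h => if h = g then 1 else 0

/-- A weakly admissible map on the `k`-skeleton: a continuous map `u` into `U(n)` such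
that for every subsimplex `Δ^{g₀,…,g_l}` (support finset `S`, `l ≤ k`) and every point `x`
of it, `u x` lies in the coset `U_g · U(𝒫(Δ^{g₀,…,g_l}))` for `g ∈ S`; equivalently the
matrix `U_g⁻¹ · u x`, whose `(i,j)` entry is `u x (g i) j`, is block diagonal for the
orbit partition of the subgroup generated by the `g₀⁻¹gᵢ`. -/
def WeaklyAdmissible (n k : ℕ)
    (u : (Equiv.Perm (Fin n) → ℝ) → Matrix (Fin n) (Fin n) ℂ) : Prop :=
  ContinuousOn u (skel n k) ∧
  (∀ x ∈ skel n k, u x ∈ Matrix.unitaryGroup (Fin n) ℂ) ∧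
  ∀ S : Finset (Equiv.Perm (Fin n)), S.Nonempty → S.card ≤ k + 1 →
    ∀ x ∈ skel n k, (∀ g ∉ S, x g = 0) →
      ∀ g ∈ S, ∀ i j : Fin n, ¬ sameOrbit (groupOf S) i j → u x (g i) j = 0

/-- An admissible map on the `k`-skeleton: weakly admissible and sending every vertex `g`
to the permutation matrix `U_g`. -/
def Admissible (n k : ℕ)
    (u : (Equiv.Perm (Fin n) → ℝ) → Matrix (Fin n) (Fin n) ℂ) : Prop :=
  WeaklyAdmissible n k u ∧ ∀ g : Equiv.Perm (Fin n), u (vertex g) = permMat g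

/-- Determinant of the `B × B` submatrix of `M`. -/
noncomputable def blockDet {n : ℕ} (B : Finset (Fin n)) (M : Matrix (Fin n) (Fin n) ℂ) : ℂ :=
  (M.submatrix (fun i : {x // x ∈ B} => i.1) (fun j : {x // x ∈ B} => j.1)).det

/-- `B` is a block (equivalence class) of the relation `r`. -/
def IsBlock {n : ℕ} (r : Fin n → Fin n → Prop) (B : Finset (Fin n)) : Prop :=
  ∃ i, ∀ j, j ∈ B ↔ r i j

/-- `l` is a continuous lift of `f` on `[0,1]` through `x ↦ exp (2 π i x)`. -/
def IsLiftOn (f : ℝ → ℂ) (l : ℝ → ℝ) : Prop :=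
  ContinuousOn l (Set.Icc 0 1) ∧
    ∀ t ∈ Set.Icc (0 : ℝ) 1, f t = Complex.exp (2 * Real.pi * Complex.I * l t)

/-- The point `ε^{g₀,g₁}(t) = (1 - t)·g₀ + t·g₁` of the edge `Δ^{g₀,g₁}`. -/
def edgePt {n : ℕ} (g0 g1 : Equiv.Perm (Fin n)) (t : ℝ) : Equiv.Perm (Fin n) → ℝ :=
  fun h => (1 - t) * (if h = g0 then 1 else 0) + t * (if h = g1 then 1 else 0)

/-- The path `γ^{g₀,g₁} = U_{g₀}⁻¹ · (u ∘ ε^{g₀,g₁})`; the `(i,j)` entry of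
`U_{g₀}⁻¹ · M` is `M (g₀ i) j`. -/
def edgePath {n : ℕ} (u : (Equiv.Perm (Fin n) → ℝ) → Matrix (Fin n) (Fin n) ℂ)
    (g0 g1 : Equiv.Perm (Fin n)) (t : ℝ) : Matrix (Fin n) (Fin n) ℂ :=
  Matrix.of fun i j => u (edgePt g0 g1 t) (g0 i) j

open Matrix in
/-- `1 + u ⊗ c` with `u` and `c` of disjoint supports is invertible. -/
theorem isUnit_det_one_add_vecMulVec {R : Type*} [CommRing R] {m : ℕ} (u c : Fin m → R)
    (h : ∀ i, u i = 0 ∨ c i = 0) : IsUnit (1 + vecMulVec u c).det := by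
  have h1 := det_one_add_replicateCol_mul_replicateRow (ι := Unit) u c
  have h2 : c ⬝ᵥ u = 0 := Finset.sum_eq_zero fun i _ => by rcases h i with h | h <;> simp [h]
  rw [← vecMulVec_eq, h2, add_zero] at h1
  simp [h1]

/-- `A` is the image under `φ` of an invertible matrix. -/
def LiftsToGL {S R : Type*} [CommRing S] [CommRing R] (φ : S →+* R) {m : Type*} [Fintype m]
    [DecidableEq m] (A : Matrix m m R) : Prop :=
  ∃ A' : Matrix m m S, IsUnit A'.det ∧ A'.map φ = A

namespace LiftsToGL

open Matrix

variable {S R : Type*} [CommRing S] [CommRing R] {φ : S →+* R}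

theorem of_mul_left {m : Type*} [Fintype m] [DecidableEq m] {P A : Matrix m m R}
    (hP : LiftsToGL φ P) (h : LiftsToGL φ (P * A)) : LiftsToGL φ A := by
  obtain ⟨P', hP', rfl⟩ := hP
  obtain ⟨Q', hQ', hQ⟩ := h
  refine ⟨P'⁻¹ * Q', by rw [det_mul]; exact (P'.isUnit_nonsing_inv_det hP').mul hQ', ?_⟩
  rw [Matrix.map_mul, hQ, ← Matrix.mul_assoc, ← Matrix.map_mul, P'.nonsing_inv_mul hP']
  simp

theorem one_add_vecMulVec (hφ : Function.Surjective φ) {m : ℕ} (u c : Fin m → R)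
    (h : ∀ i, u i = 0 ∨ c i = 0) : LiftsToGL φ (1 + vecMulVec u c) := by
  have hσ : ∀ r : R, ∃ s, φ s = r ∧ (r = 0 → s = 0) := fun r => by
    by_cases hr : r = 0
    · exact ⟨0, by simp [hr], fun _ => rfl⟩
    · obtain ⟨s, hs⟩ := hφ r
      exact ⟨s, hs, fun h => absurd h hr⟩
  choose σ hσ hσ0 using hσ
  refine ⟨1 + vecMulVec (σ ∘ u) (σ ∘ c), isUnit_det_one_add_vecMulVec _ _ fun i => ?_, ?_⟩
  · exact (h i).imp (hσ0 _) (hσ0 _)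
  · ext i j
    simp [vecMulVec_apply, hσ, Matrix.one_apply, apply_ite φ]

theorem of_first_col (hφ : Function.Surjective φ) {m : ℕ}
    (ih : ∀ A : Matrix (Fin m) (Fin m) R, (∃ s, IsUnit s ∧ φ s = A.det) → LiftsToGL φ A)
    (A : Matrix (Fin (m + 1)) (Fin (m + 1)) R) (hA : ∃ s, IsUnit s ∧ φ s = A.det)
    (h0 : A 0 0 = 1) (h1 : ∀ i : Fin m, A i.succ 0 = 0) : LiftsToGL φ A := by
  have hdet : A.det = (A.submatrix Fin.succ Fin.succ).det := by
    rw [det_succ_column_zero, Fin.sum_univ_succ]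
    simp [h0, h1]
  obtain ⟨B', hB', hB⟩ := ih (A.submatrix Fin.succ Fin.succ) (hdet ▸ hA)
  choose σ hσ using hφ
  refine ⟨Matrix.of (Fin.cons (Fin.cons 1 fun j => σ (A 0 j.succ))
    fun i => Fin.cons 0 fun j => B' i j), ?_, ?_⟩
  · rw [det_succ_column_zero, Fin.sum_univ_succ]
    simp only [of_apply, Fin.cons_zero, Fin.cons_succ, Fin.val_zero, pow_zero, one_mul, mul_zero,
      zero_mul, Finset.sum_const_zero, add_zero]
    exact hB'
  · ext i j
    refine Fin.cases ?_ (fun i => ?_) i <;> refine Fin.cases ?_ (fun j => ?_) j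
    · simp [h0]
    · simp [hσ]
    · simp [h1]
    · simpa using congr_fun (congr_fun hB i) j

/-- Left multiplication by `1 + u ⊗ c` does not affect whether a matrix lifts. -/
theorem reduce (hφ : Function.Surjective φ) {m : ℕ} {A : Matrix (Fin m) (Fin m) R}
    (hA : ∃ s, IsUnit s ∧ φ s = A.det) (u c : Fin m → R) (h : ∀ i, u i = 0 ∨ c i = 0)
    (H : (∃ s, IsUnit s ∧ φ s = ((1 + vecMulVec u c) * A).det) →
      LiftsToGL φ ((1 + vecMulVec u c) * A)) : LiftsToGL φ A := by
  have hP := one_add_vecMulVec hφ u c h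
  refine hP.of_mul_left (H ?_)
  obtain ⟨P', hP', hP⟩ := hP
  obtain ⟨s, hs, hsA⟩ := hA
  refine ⟨P'.det * s, hP'.mul hs, ?_⟩
  rw [det_mul, map_mul, hsA, ← hP, RingHom.map_det, RingHom.mapMatrix_apply]

theorem one_add_vecMulVec_mul_apply {m : ℕ} (u c : Fin m → R) (A : Matrix (Fin m) (Fin m) R)
    (i j : Fin m) : ((1 + vecMulVec u c) * A) i j = A i j + u i * ∑ k, c k * A k j := by
  rw [Matrix.add_mul, Matrix.one_mul, Matrix.add_apply, Matrix.mul_apply]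
  simp only [vecMulVec_apply, Finset.mul_sum, mul_assoc]

/-- Over a ring of stable rank one, a matrix whose determinant lifts to a unit along a surjection
lifts to an invertible matrix. -/
theorem of_det (hφ : Function.Surjective φ)
    (hR : ∀ a b : R, IsCoprime a b → ∃ c, IsUnit (a + b * c)) (m : ℕ) :
    ∀ A : Matrix (Fin m) (Fin m) R, (∃ s, IsUnit s ∧ φ s = A.det) → LiftsToGL φ A := by
  induction m with
  | zero => exact fun A _ => ⟨1, by simp, Subsingleton.elim _ _⟩
  | succ m ih =>
    have key0 : ∀ A : Matrix (Fin (m + 1)) (Fin (m + 1)) R, (∃ s, IsUnit s ∧ φ s = A.det) →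
        A 0 0 = 1 → LiftsToGL φ A := by
      intro A hA h0
      refine reduce hφ hA (Fin.cons 0 fun i => - A i.succ 0) (Pi.single 0 1) (fun i => ?_)
        fun hB => of_first_col hφ ih _ hB ?_ fun i => ?_
      · refine Fin.cases ?_ (fun i => ?_) i <;> simp
      · simp [one_add_vecMulVec_mul_apply, h0]
      · simp [one_add_vecMulVec_mul_apply, h0, Pi.single_apply]
    cases m with
    | zero =>
      rintro A ⟨s, hs, hsA⟩
      refine ⟨Matrix.of fun _ _ => s, by simpa using hs, ?_⟩
      ext i j
      obtain rfl : i = 0 := Fin.fin_one_eq_zero i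
      obtain rfl : j = 0 := Fin.fin_one_eq_zero j
      simp [hsA]
    | succ m =>
      have key1 : ∀ A : Matrix (Fin (m + 2)) (Fin (m + 2)) R, (∃ s, IsUnit s ∧ φ s = A.det) →
          A 1 0 = 1 → LiftsToGL φ A := by
        intro A hA h1
        refine reduce hφ hA (Pi.single 0 1) (Pi.single 1 (1 - A 0 0)) (fun i => ?_)
          fun hB => key0 _ hB ?_
        · by_cases hi : i = 0 <;> simp [hi]
        · simp [one_add_vecMulVec_mul_apply, h1, Pi.single_apply]
      have key2 : ∀ A : Matrix (Fin (m + 2)) (Fin (m + 2)) R, (∃ s, IsUnit s ∧ φ s = A.det) →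
          IsUnit (A 0 0) → LiftsToGL φ A := by
        intro A hA h0
        obtain ⟨v, hv⟩ := h0.exists_right_inv
        refine reduce hφ hA (Pi.single 1 1) (Pi.single 0 (v * (1 - A 1 0))) (fun i => ?_)
          fun hB => key1 _ hB ?_
        · by_cases hi : i = 0 <;> simp [hi]
        · simp only [one_add_vecMulVec_mul_apply, Pi.single_apply, ite_mul, zero_mul,
            Finset.sum_ite_eq', Finset.mem_univ, if_true]
          linear_combination (1 - A 1 0) * hv
      rintro A ⟨s, hs, hsA⟩
      obtain ⟨d, hd⟩ := ((hs.map φ).exists_right_inv)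
      obtain ⟨r, hr⟩ : ∃ r : Fin (m + 2) → R, ∑ k, r k * A k 0 = 1 := by
        refine ⟨fun k => d * A.adjugate 0 k, ?_⟩
        have h : (A.adjugate * A) 0 0 = A.det := by simp [A.adjugate_mul]
        rw [Matrix.mul_apply] at h
        simp only [mul_assoc, ← Finset.mul_sum]
        rw [h, ← hsA, mul_comm, hd]
      rw [Fin.sum_univ_succ] at hr
      obtain ⟨c, hc⟩ := hR (A 0 0) (∑ i : Fin (m + 1), r i.succ * A i.succ 0)
        ⟨r 0, 1, by rw [one_mul, hr]⟩
      refine reduce hφ ⟨s, hs, hsA⟩ (Pi.single 0 1)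
        (Fin.cons 0 fun i => c * r i.succ) (fun i => ?_) fun hB => key2 _ hB ?_
      · refine Fin.cases ?_ (fun i => ?_) i <;> simp
      · rw [one_add_vecMulVec_mul_apply, Fin.sum_univ_succ]
        simp only [Pi.single_eq_same, Fin.cons_zero, Fin.cons_succ, zero_mul, zero_add, one_mul,
          mul_assoc, ← Finset.mul_sum]
        rwa [mul_comm c]

/-- Version of `of_det` for matrices indexed by an arbitrary finite type. -/
theorem of_det_fintype (hφ : Function.Surjective φ)
    (hR : ∀ a b : R, IsCoprime a b → ∃ c, IsUnit (a + b * c)) {m : Type*} [Fintype m]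
    [DecidableEq m] (A : Matrix m m R) (hA : ∃ s, IsUnit s ∧ φ s = A.det) : LiftsToGL φ A := by
  let e := Fintype.equivFin m
  obtain ⟨B, hB, hBA⟩ := of_det hφ hR _ (A.submatrix e.symm e.symm) (by simpa using hA)
  refine ⟨B.submatrix e e, by simpa using hB, ?_⟩
  ext i j
  simpa using congr_fun (congr_fun hBA (e i)) (e j)

end LiftsToGL

open Set in
theorem exists_nowhere_zero_approx {E : Type*} [NormedAddCommGroup E] [NormedSpace ℝ E]
    [FiniteDimensional ℝ E] {Y : Set E} (hY : IsClosed Y) (hdim : dimH Y < 2) (f : C(Y, ℂ))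
    {ε : ℝ} (hε : 0 < ε) : ∃ g : C(Y, ℂ), (∀ y, g y ≠ 0) ∧ ∀ y, ‖g y - f y‖ < ε := by
  obtain ⟨F, rfl⟩ := ContinuousMap.exists_restrict_eq hY f
  obtain ⟨G, hG, hGF, -⟩ := F.continuous.exists_contDiff_approx (n := 1) (ε := fun _ => ε / 2)
    continuous_const fun _ => half_pos hε
  have hd : Dense (G '' Y)ᶜ := by
    refine hG.contDiffOn.dense_compl_image_of_dimH_lt_finrank convex_univ (subset_univ Y) ?_
    simpa [Complex.finrank_real_complex] using hdim
  obtain ⟨w, hw, hwε⟩ := hd.exists_mem_open Metric.isOpen_ball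
    ⟨0, Metric.mem_ball_self (half_pos hε)⟩
  refine ⟨⟨fun y => G y - w, by have := hG.continuous; fun_prop⟩, fun y h => ?_, fun y => ?_⟩
  · exact hw ⟨y, y.2, sub_eq_zero.1 h⟩
  · have h1 : ‖G y - F y‖ < ε / 2 := by simpa [dist_eq_norm] using hGF y
    have h2 : ‖w‖ < ε / 2 := by simpa using hwε
    calc ‖G y - w - F y‖ = ‖(G y - F y) - w‖ := by congr 1; ring
      _ ≤ _ := norm_sub_le _ _
      _ < ε := by linarith

/-- Continuous functions on a compact set of dimension less than two have stable rank one. -/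
theorem exists_isUnit_add_mul {E : Type*} [NormedAddCommGroup E] [NormedSpace ℝ E]
    [FiniteDimensional ℝ E] {Y : Set E} (hY : IsCompact Y) (hdim : dimH Y < 2) (a b : C(Y, ℂ))
    (hab : IsCoprime a b) : ∃ c, IsUnit (a + b * c) := by
  have := isCompact_iff_compactSpace.1 hY
  obtain ⟨x, y, hxy⟩ := hab
  obtain ⟨g, hg0, hg⟩ := exists_nowhere_zero_approx hY.isClosed hdim x
    (ε := (‖a‖ + 1)⁻¹) (by positivity)
  obtain ⟨v, hv⟩ := (ContinuousMap.isUnit_iff_forall_ne_zero g).2 hg0 |>.exists_right_inv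
  refine ⟨y * v, (ContinuousMap.isUnit_iff_forall_ne_zero _).2 fun t ht => ?_⟩
  have hxyt := DFunLike.congr_fun hxy t
  have hvt := DFunLike.congr_fun hv t
  simp only [ContinuousMap.add_apply, ContinuousMap.mul_apply, ContinuousMap.one_apply] at *
  have h1 : (g t - x t) * a t = -1 := by linear_combination g t * ht - b t * y t * hvt - hxyt
  have h2 : ‖g t - x t‖ * ‖a t‖ = 1 := by rw [← norm_mul, h1]; simp
  have h3 := a.norm_coe_le_norm t
  have h4 : (‖a‖ + 1)⁻¹ * ‖a t‖ < 1 := by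
    rw [inv_mul_lt_iff₀ (by positivity)]; linarith
  nlinarith [hg t, norm_nonneg (a t)]

section Polar

open scoped Matrix.Norms.L2Operator MatrixOrder ComplexOrder

/-- A continuous retraction of the invertible matrices onto the unitary group. -/
theorem exists_unitary_retraction {X m : Type*} [TopologicalSpace X] [Fintype m] [DecidableEq m]
    (A : X → Matrix m m ℂ) (hA : Continuous A) (hdet : ∀ x, IsUnit (A x).det) :
    ∃ B : X → Matrix m m ℂ, Continuous B ∧ (∀ x, B x ∈ Matrix.unitaryGroup m ℂ) ∧
      ∀ x, A x ∈ Matrix.unitaryGroup m ℂ → B x = A x := by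
  have hpos : ∀ x, IsStrictlyPositive (star (A x) * A x) := fun x => by
    have hu : IsUnit (A x) := (Matrix.isUnit_iff_isUnit_det _).2 (hdet x)
    exact IsStrictlyPositive.iff_of_unital.2 ⟨star_mul_self_nonneg _, hu.star.mul hu⟩
  refine ⟨fun x => A x * (star (A x) * A x) ^ (-(1 / 2) : ℝ), ?_, fun x => ?_, fun x hx => ?_⟩
  · refine hA.mul ?_
    simp only [CFC.rpow_def]
    have hc : Continuous fun x => star (A x) * A x := hA.star.mul hA
    rw [← continuousOn_univ] at hc ⊢
    refine ContinuousOn.cfc_nnreal_of_mem_nhdsSet (s := {0}ᶜ) _ ?_ hc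
      (fun x _ => star_mul_self_nonneg _) ?_
    · refine isOpen_compl_singleton.mem_nhdsSet.2 (Set.iUnion₂_subset fun x _ r hr h0 => ?_)
      rw [Set.mem_singleton_iff] at h0
      subst h0
      exact spectrum.zero_notMem _ (hpos x).isUnit hr
    · exact fun r hr => (NNReal.continuousAt_rpow_const (Or.inl hr)).continuousWithinAt
  · have hsa : star ((star (A x) * A x) ^ (-(1 / 2) : ℝ)) = (star (A x) * A x) ^ (-(1 / 2) : ℝ) :=
      (IsSelfAdjoint.of_nonneg CFC.rpow_nonneg).star_eq
    rw [Matrix.mem_unitaryGroup_iff', star_mul, hsa, mul_assoc, ← mul_assoc (star (A x))]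
    nth_rewrite 2 [← CFC.rpow_one (star (A x) * A x) (hpos x).nonneg]
    rw [← CFC.rpow_add (hpos x).isUnit, ← CFC.rpow_add (hpos x).isUnit]
    norm_num
    exact CFC.rpow_zero _ (hpos x).nonneg
  · simp only [Matrix.mem_unitaryGroup_iff'.1 hx, CFC.one_rpow, mul_one]

end Polar

/-- A continuous map from a compact set of dimension less than two to the unitary group extends
continuously if its determinant has a continuous logarithm. -/
theorem exists_unitary_extension {E : Type*} [NormedAddCommGroup E] [NormedSpace ℝ E]
    [FiniteDimensional ℝ E] {Y : Set E} (hY : IsCompact Y) (hdim : dimH Y < 2)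
    {m : Type*} [Fintype m] [DecidableEq m] (A : E → Matrix m m ℂ) (hA : ContinuousOn A Y)
    (hU : ∀ y ∈ Y, A y ∈ Matrix.unitaryGroup m ℂ) (θ : E → ℂ) (hθ : ContinuousOn θ Y)
    (hdet : ∀ y ∈ Y, (A y).det = Complex.exp (θ y)) :
    ∃ B : E → Matrix m m ℂ, Continuous B ∧ (∀ x, B x ∈ Matrix.unitaryGroup m ℂ) ∧
      ∀ y ∈ Y, B y = A y := by
  let φ : C(E, ℂ) →+* C(Y, ℂ) :=
    (ContinuousMap.compRightAlgHom ℂ ℂ ⟨((↑) : Y → E), continuous_subtype_val⟩).toRingHom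
  have hφ : Function.Surjective φ := fun f => ContinuousMap.exists_restrict_eq hY.isClosed f
  have hφa : ∀ f (y : Y), φ f y = f y := fun _ _ => rfl
  obtain ⟨Θ, hΘ⟩ := ContinuousMap.exists_restrict_eq hY.isClosed
    ⟨Y.domRestrict θ, continuousOn_iff_continuous_domRestrict.1 hθ⟩
  let M : Matrix m m C(Y, ℂ) := Matrix.of fun i j =>
    ⟨fun y => A y i j, (continuousOn_iff_continuous_domRestrict.1 hA).matrix_elem i j⟩
  have hev : ∀ {X : Type _} [TopologicalSpace X] (N : Matrix m m C(X, ℂ)) (x : X),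
      N.det x = (Matrix.of fun i j => N i j x).det := fun N x =>
    RingHom.map_det (ContinuousMap.evalAlgHom ℂ ℂ x : C(_, ℂ) →ₐ[ℂ] ℂ).toRingHom N
  have hM : ∃ s, IsUnit s ∧ φ s = M.det := by
    refine ⟨⟨fun x => Complex.exp (Θ x), by fun_prop⟩,
      (ContinuousMap.isUnit_iff_forall_ne_zero _).2 fun _ => Complex.exp_ne_zero _, ?_⟩
    ext y
    rw [hev]
    have := DFunLike.congr_fun hΘ y
    simp only [ContinuousMap.restrict_apply] at this
    simp [hφa, this, M, ← hdet y y.2]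
    rfl
  obtain ⟨N, hN, hNM⟩ := LiftsToGL.of_det_fintype hφ (exists_isUnit_add_mul hY hdim) M hM
  obtain ⟨B, hBc, hBU, hB⟩ := exists_unitary_retraction (fun x => Matrix.of fun i j => N i j x)
    (continuous_matrix fun i j => (N i j).continuous) fun x => by
      rw [← hev]
      exact (hN.map (ContinuousMap.evalAlgHom ℂ ℂ x : C(_, ℂ) →ₐ[ℂ] ℂ))
  have hNA : ∀ y ∈ Y, (Matrix.of fun i j => N i j y) = A y := fun y hy => by
    ext i j
    exact DFunLike.congr_fun (congr_fun (congr_fun hNM i) j) ⟨y, hy⟩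
  exact ⟨B, hBc, hBU, fun y hy => by rw [hB y (by rw [hNA y hy]; exact hU y hy), hNA y hy]⟩

/-! ### Block decompositions -/

theorem sameOrbit_equivalence {n : ℕ} (G : Subgroup (Equiv.Perm (Fin n))) :
    Equivalence (sameOrbit G) where
  refl i := ⟨1, G.one_mem, rfl⟩
  symm := by
    rintro i _ ⟨p, hp, rfl⟩
    exact ⟨p⁻¹, G.inv_mem hp, by simp⟩
  trans := by
    rintro i _ _ ⟨p, hp, rfl⟩ ⟨q, hq, rfl⟩
    exact ⟨q * p, G.mul_mem hq hp, rfl⟩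

theorem groupOf_mono {n : ℕ} {S T : Finset (Equiv.Perm (Fin n))} (h : S ⊆ T) :
    groupOf S ≤ groupOf T :=
  Subgroup.closure_mono fun _ ⟨a, ha, b, hb, hq⟩ => ⟨a, h ha, b, h hb, hq⟩

theorem inv_mul_mem_groupOf {n : ℕ} {S : Finset (Equiv.Perm (Fin n))} {g h : Equiv.Perm (Fin n)}
    (hg : g ∈ S) (hh : h ∈ S) : g⁻¹ * h ∈ groupOf S :=
  Subgroup.subset_closure ⟨g, hg, h, hh, rfl⟩

theorem IsBlock.mem_iff {n : ℕ} {r : Fin n → Fin n → Prop} (hr : Equivalence r)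
    {B : Finset (Fin n)} (hB : IsBlock r B) {i j : Fin n} (hi : i ∈ B) : j ∈ B ↔ r i j := by
  obtain ⟨k, hk⟩ := hB
  rw [hk] at *
  exact ⟨fun hj => hr.trans (hr.symm hi) hj, fun hj => hr.trans hi hj⟩

/-- The diagonal blocks of a block diagonal unitary matrix are unitary. -/
theorem IsBlock.submatrix_mem_unitaryGroup {n : ℕ} {r : Fin n → Fin n → Prop} (hr : Equivalence r)
    {B : Finset (Fin n)} (hB : IsBlock r B) {M : Matrix (Fin n) (Fin n) ℂ}
    (hM : M ∈ Matrix.unitaryGroup (Fin n) ℂ) (h0 : ∀ i j, ¬ r i j → M i j = 0) :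
    M.submatrix (fun i : {x // x ∈ B} => i.1) (fun j : {x // x ∈ B} => j.1) ∈
      Matrix.unitaryGroup {x // x ∈ B} ℂ := by
  rw [Matrix.mem_unitaryGroup_iff] at hM ⊢
  ext i k
  have h := congr_fun (congr_fun hM i) k
  rw [Matrix.mul_apply] at h ⊢
  simp only [Matrix.one_apply, ← Subtype.ext_iff] at h ⊢
  rw [← h]
  simp only [Matrix.submatrix_apply, Matrix.star_apply]
  refine (Finset.sum_coe_sort B fun j => M i j * star (M k j)).trans
    (Finset.sum_subset B.subset_univ fun j _ hj => ?_)
  rw [h0 i j fun h => hj ((hB.mem_iff hr i.2).2 h), zero_mul]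

theorem norm_det_of_mem_unitaryGroup {m : Type*} [Fintype m] [DecidableEq m] {M : Matrix m m ℂ}
    (hM : M ∈ Matrix.unitaryGroup m ℂ) : ‖M.det‖ = 1 := by
  exact CStarRing.norm_of_mem_unitary (Matrix.det_of_mem_unitary hM)

/-- Permuting the rows by a permutation preserving a block changes the block determinant by a
nonzero constant. -/
theorem exists_blockDet_permute {n : ℕ} {G : Subgroup (Equiv.Perm (Fin n))} {B : Finset (Fin n)}
    (hB : IsBlock (sameOrbit G) B) {p : Equiv.Perm (Fin n)} (hp : p ∈ G) :
    ∃ c : ℂ, c ≠ 0 ∧ ∀ M : Matrix (Fin n) (Fin n) ℂ,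
      blockDet B (M.submatrix p id) = c * blockDet B M := by
  have hpB : ∀ i, i ∈ B ↔ p i ∈ B := fun i => by
    have hr := sameOrbit_equivalence G
    exact ⟨fun h => (hB.mem_iff hr h).2 ⟨p, hp, rfl⟩,
      fun h => (hB.mem_iff hr h).2 (hr.symm ⟨p, hp, rfl⟩)⟩
  let q : Equiv.Perm {x // x ∈ B} := p.subtypePerm fun i => (hpB i).symm
  refine ⟨((Equiv.Perm.sign q : ℤ) : ℂ), by simp, fun M => ?_⟩
  rw [blockDet, blockDet, ← Matrix.det_permute]
  rfl

/-- Blockwise version of `exists_unitary_extension`. -/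
theorem exists_blockDiagonal_unitary_extension {E : Type*} [NormedAddCommGroup E] [NormedSpace ℝ E]
    [FiniteDimensional ℝ E] {Y : Set E} (hY : IsCompact Y) (hdim : dimH Y < 2) {n : ℕ}
    {r : Fin n → Fin n → Prop} (hr : Equivalence r)
    (A : E → Matrix (Fin n) (Fin n) ℂ) (hA : ContinuousOn A Y)
    (hU : ∀ y ∈ Y, A y ∈ Matrix.unitaryGroup (Fin n) ℂ) (h0 : ∀ y ∈ Y, ∀ i j, ¬ r i j → A y i j = 0)
    (hdet : ∀ B, IsBlock r B →
      ∃ θ : E → ℂ, ContinuousOn θ Y ∧ ∀ y ∈ Y, blockDet B (A y) = Complex.exp (θ y)) :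
    ∃ N : E → Matrix (Fin n) (Fin n) ℂ, Continuous N ∧
      (∀ x, N x ∈ Matrix.unitaryGroup (Fin n) ℂ) ∧ (∀ x i j, ¬ r i j → N x i j = 0) ∧
      ∀ y ∈ Y, N y = A y := by
  classical
  have hW : ∀ B : Finset (Fin n), ∃ W : E → Matrix {x // x ∈ B} {x // x ∈ B} ℂ, IsBlock r B →
      Continuous W ∧ (∀ x, W x ∈ Matrix.unitaryGroup {x // x ∈ B} ℂ) ∧
      ∀ y ∈ Y, W y = (A y).submatrix Subtype.val Subtype.val := by
    intro B
    by_cases hB : IsBlock r B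
    · obtain ⟨θ, hθ, hθd⟩ := hdet B hB
      obtain ⟨W, h⟩ := exists_unitary_extension hY hdim
        (fun x => (A x).submatrix (Subtype.val : {x // x ∈ B} → Fin n) Subtype.val)
        ((continuous_id.matrix_submatrix _ _).comp_continuousOn hA)
        (fun y hy => hB.submatrix_mem_unitaryGroup hr (hU y hy) (h0 y hy)) θ hθ hθd
      exact ⟨W, fun _ => h⟩
    · exact ⟨fun _ => 0, fun h => absurd h hB⟩
  choose W hW using hW
  let cls : Fin n → Finset (Fin n) := fun i => Finset.univ.filter (r i)
  have hcls : ∀ i, IsBlock r (cls i) := fun i => ⟨i, fun j => by simp [cls]⟩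
  have hself : ∀ i, i ∈ cls i := fun i => by simpa [cls] using hr.refl i
  let pad : Finset (Fin n) → E → Matrix (Fin n) (Fin n) ℂ := fun B x => Matrix.of fun i j =>
    if h : i ∈ B ∧ j ∈ B then W B x ⟨i, h.1⟩ ⟨j, h.2⟩ else 0
  have hpadc : ∀ B, IsBlock r B → ∀ i j, Continuous fun x => pad B x i j := by
    intro B hB i j
    by_cases h : i ∈ B ∧ j ∈ B
    · simpa [pad, h] using (hW B hB).1.matrix_elem _ _
    · simpa [pad, h] using continuous_const
  have hpadU : ∀ B, IsBlock r B → ∀ x, ∀ i ∈ B, ∀ k ∈ B,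
      ∑ j, pad B x i j * star (pad B x k j) = if i = k then 1 else 0 := by
    intro B hB x i hi k hk
    have h := congr_fun (congr_fun (Matrix.mem_unitaryGroup_iff.1 ((hW B hB).2.1 x)) ⟨i, hi⟩)
      ⟨k, hk⟩
    rw [Matrix.mul_apply, Matrix.one_apply] at h
    simp only [Subtype.mk.injEq] at h
    rw [← h, ← Finset.sum_subset B.subset_univ fun j _ hj => by simp [pad, hj],
      ← Finset.sum_coe_sort]
    exact Finset.sum_congr rfl fun j _ => by simp [pad, hi, hk, Matrix.star_apply]
  have hzero : ∀ x i j, ¬ r i j → pad (cls i) x i j = 0 := fun x i j h => by simp [pad, cls, h]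
  refine ⟨fun x => Matrix.of fun i j => pad (cls i) x i j,
    continuous_matrix fun i j => hpadc _ (hcls i) i j, fun x => ?_, hzero, fun y hy => ?_⟩
  · rw [Matrix.mem_unitaryGroup_iff]
    ext i k
    rw [Matrix.mul_apply, Matrix.one_apply]
    simp only [Matrix.star_apply, Matrix.of_apply]
    by_cases hik : r i k
    · have hc : cls k = cls i := by
        ext j
        simpa [cls] using ⟨fun h => hr.trans hik h, fun h => hr.trans (hr.symm hik) h⟩
      rw [hc]
      exact hpadU _ (hcls i) x i (hself i) k (hc ▸ hself k)
    · rw [if_neg fun h : i = k => hik (h ▸ hr.refl i)]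
      refine Finset.sum_eq_zero fun j _ => ?_
      by_cases hij : r i j
      · rw [hzero x k j fun hkj => hik (hr.trans hij (hr.symm hkj)), star_zero, mul_zero]
      · rw [hzero x i j hij, zero_mul]
  · ext i j
    by_cases hij : r i j
    · simp [pad, (hW _ (hcls i)).2.2 y hy, hr.refl, hij, cls]
    · simpa [h0 y hy i j hij] using hzero y i j hij

/-! ### Logarithms along paths -/

/-- Two continuous logarithms along a path of functions differing by a constant factor have the same
increment. -/
theorem sub_eq_sub_of_exp_eq_mul_exp {f g : ℝ → ℂ} {c : ℂ} (hf : ContinuousOn f (Set.Icc 0 1))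
    (hg : ContinuousOn g (Set.Icc 0 1))
    (h : ∀ t ∈ Set.Icc (0 : ℝ) 1, Complex.exp (f t) = c * Complex.exp (g t)) :
    f 1 - f 0 = g 1 - g 0 := by
  have h0 : (0 : ℝ) ∈ Set.Icc (0 : ℝ) 1 := by simp
  have h1 : (1 : ℝ) ∈ Set.Icc (0 : ℝ) 1 := by simp
  have hc : ∀ t ∈ Set.Icc (0 : ℝ) 1, Complex.exp (f t - g t) = c := fun t ht => by
    rw [Complex.exp_sub, h t ht, mul_div_cancel_right₀ _ (Complex.exp_ne_zero _)]
  have hpi := Complex.two_pi_I_ne_zero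
  let k : ℝ → ℝ := fun t => ((f t - g t - (f 0 - g 0)) / (2 * Real.pi * Complex.I)).re
  have hk : ∀ t ∈ Set.Icc (0 : ℝ) 1,
      ∃ m : ℤ, f t - g t - (f 0 - g 0) = m * (2 * Real.pi * Complex.I) := fun t ht => by
    obtain ⟨m, hm⟩ := Complex.exp_eq_exp_iff_exists_int.1 ((hc t ht).trans (hc 0 h0).symm)
    exact ⟨m, by rw [hm]; ring⟩
  have hkm : Set.MapsTo k (Set.Icc 0 1) (Set.range ((↑) : ℤ → ℝ)) := fun t ht => by
    obtain ⟨m, hm⟩ := hk t ht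
    exact ⟨m, by simp only [k, hm, mul_div_cancel_right₀ _ hpi, Complex.intCast_re]⟩
  have hkc : ContinuousOn k (Set.Icc 0 1) :=
    Complex.continuous_re.comp_continuousOn
      (((hf.sub hg).sub continuousOn_const).div_const _)
  have hd : IsDiscrete (Set.range ((↑) : ℤ → ℝ)) :=
    ⟨Int.isClosedEmbedding_coe_real.isEmbedding.toHomeomorph.symm.isEmbedding.discreteTopology⟩
  obtain ⟨z, -, hz⟩ := isPreconnected_Icc.eqOn_const_of_mapsTo hd hkc hkm ⟨_, hkm h0⟩
  obtain ⟨m, hm⟩ := hk 1 h1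
  have hk1 : k 1 = k 0 := (hz h1).trans (hz h0).symm
  simp only [k, hm, mul_div_cancel_right₀ _ hpi, sub_self, zero_div, Complex.zero_re,
    Complex.intCast_re, Int.cast_eq_zero] at hk1
  rw [hk1, Int.cast_zero, zero_mul] at hm
  linear_combination hm

/-- Nowhere vanishing functions on a contractible, locally path connected space have a continuous
logarithm. -/
theorem exists_continuous_exp_eq {X : Type*} [TopologicalSpace X] [LocallyPathConnectedSpace X]
    [ContractibleSpace X] {f : X → ℂ} (hf : Continuous f) (h0 : ∀ x, f x ≠ 0) :
    ∃ l : X → ℂ, Continuous l ∧ ∀ x, Complex.exp (l x) = f x := by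
  obtain ⟨l, hl, hlf⟩ := Complex.exists_continuousOn_eqOn_exp_comp (U := Set.univ)
    (Homeomorph.Set.univ X).toHomotopyEquiv.simplyConnectedSpace isOpen_univ hf.continuousOn
    (by simpa using h0)
  exact ⟨l, continuousOn_univ.1 hl, fun x => hlf (Set.mem_univ x)⟩

theorem exists_isLiftOn {f : ℝ → ℂ} (hf : ContinuousOn f (Set.Icc 0 1))
    (h1 : ∀ t ∈ Set.Icc (0 : ℝ) 1, ‖f t‖ = 1) : ∃ l, IsLiftOn f l := by
  have hc : Continuous fun t => f (Set.projIcc (0 : ℝ) 1 zero_le_one t) :=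
    hf.comp_continuous (by fun_prop) fun t => (Set.projIcc (0 : ℝ) 1 zero_le_one t).2
  obtain ⟨l, hl, hlf⟩ := exists_continuous_exp_eq hc fun t h => by
    have := h1 _ (Set.projIcc (0 : ℝ) 1 zero_le_one t).2
    simp [h] at this
  refine ⟨fun t => (l t).im / (2 * Real.pi), by fun_prop, fun t ht => ?_⟩
  have hlt := hlf t
  rw [Set.projIcc_of_mem zero_le_one ht] at hlt
  have hre : (l t).re = 0 := by
    rw [← Real.exp_eq_one_iff, ← Complex.norm_exp, hlt]
    exact h1 t ht
  have him : l t = (l t).im * Complex.I := by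
    apply Complex.ext <;> simp [hre]
  have hpi : (Real.pi : ℂ) ≠ 0 := by exact_mod_cast Real.pi_ne_zero
  rw [← hlt, him]
  congr 1
  simp only [Complex.ofReal_div, Complex.ofReal_mul, Complex.ofReal_ofNat]
  field_simp

/-! ### Faces of the simplex -/

/-- The closed face of the simplex with vertex set `S`. -/
def face {n : ℕ} (S : Finset (Equiv.Perm (Fin n))) : Set (Equiv.Perm (Fin n) → ℝ) :=
  {x | (∀ g, 0 ≤ x g) ∧ (∑ g, x g) = 1 ∧ ∀ g ∉ S, x g = 0}

theorem mem_skel_of_mem_face {n k : ℕ} {S : Finset (Equiv.Perm (Fin n))} (hS : S.card ≤ k + 1)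
    {x : Equiv.Perm (Fin n) → ℝ} (hx : x ∈ face S) : x ∈ skel n k := by
  refine ⟨hx.1, hx.2.1, (Finset.card_le_card fun g hg => ?_).trans hS⟩
  by_contra h
  exact (Finset.mem_filter.1 hg).2 (hx.2.2 g h)

theorem mem_face_support {n k : ℕ} {x : Equiv.Perm (Fin n) → ℝ} (hx : x ∈ skel n k) :
    x ∈ face (Finset.univ.filter fun g => x g ≠ 0) :=
  ⟨hx.1, hx.2.1, fun g hg => by simpa using hg⟩

theorem skel_eq_iUnion_face (n k : ℕ) :
    skel n k = ⋃ S : {S : Finset (Equiv.Perm (Fin n)) // S.card ≤ k + 1}, face S.1 := by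
  ext x
  rw [Set.mem_iUnion]
  exact ⟨fun hx => ⟨⟨_, hx.2.2⟩, mem_face_support hx⟩, fun ⟨S, hS⟩ => mem_skel_of_mem_face S.2 hS⟩

theorem isClosed_face {n : ℕ} (S : Finset (Equiv.Perm (Fin n))) : IsClosed (face S) := by
  have : face S = (⋂ g, {x | 0 ≤ x g}) ∩ {x | (∑ g, x g) = 1} ∩ ⋂ g ∉ S, {x | x g = 0} := by
    ext x
    simp [face, and_assoc]
  rw [this]
  refine ((isClosed_iInter fun g => ?_).inter ?_).inter
    (isClosed_iInter fun g => isClosed_iInter fun _ => ?_)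
  · exact isClosed_le continuous_const (continuous_apply g)
  · exact isClosed_eq (by fun_prop) continuous_const
  · exact isClosed_eq (continuous_apply g) continuous_const

theorem isCompact_face {n : ℕ} (S : Finset (Equiv.Perm (Fin n))) : IsCompact (face S) := by
  have hI : IsCompact (Set.univ.pi fun _ : Equiv.Perm (Fin n) => Set.Icc (0 : ℝ) 1) :=
    isCompact_univ_pi fun _ => isCompact_Icc
  refine hI.of_isClosed_subset (isClosed_face S) fun x hx g _ => ⟨hx.1 g, ?_⟩
  rw [← hx.2.1]
  exact Finset.single_le_sum (fun g _ => hx.1 g) (Finset.mem_univ g)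

theorem isClosed_skel (n k : ℕ) : IsClosed (skel n k) := by
  rw [skel_eq_iUnion_face]
  exact isClosed_iUnion_of_finite fun S => isClosed_face S.1

theorem skel_mono (n : ℕ) {k l : ℕ} (h : k ≤ l) : skel n k ⊆ skel n l :=
  fun _ hx => ⟨hx.1, hx.2.1, hx.2.2.trans (by omega)⟩

theorem edgePt_mem_face {n : ℕ} {S : Finset (Equiv.Perm (Fin n))} {a b : Equiv.Perm (Fin n)}
    (ha : a ∈ S) (hb : b ∈ S) {t : ℝ} (ht : t ∈ Set.Icc (0 : ℝ) 1) : edgePt a b t ∈ face S := by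
  refine ⟨fun g => ?_, ?_, fun g hg => ?_⟩
  · have h0 := ht.1
    have h1 := sub_nonneg.2 ht.2
    unfold edgePt
    positivity
  · simp [edgePt, Finset.sum_add_distrib]
  · have h1 : g ≠ a := fun h => hg (h ▸ ha)
    have h2 : g ≠ b := fun h => hg (h ▸ hb)
    simp [edgePt, h1, h2]

theorem edgePt_mem_skel {n : ℕ} (a b : Equiv.Perm (Fin n)) {t : ℝ} (ht : t ∈ Set.Icc (0 : ℝ) 1) :
    edgePt a b t ∈ skel n 1 :=
  mem_skel_of_mem_face (S := {a, b}) Finset.card_le_two (edgePt_mem_face (by simp) (by simp) ht)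

theorem continuous_edgePt {n : ℕ} (a b : Equiv.Perm (Fin n)) : Continuous (edgePt a b) :=
  continuous_pi fun h => by
    unfold edgePt
    fun_prop

theorem eq_edgePt {n : ℕ} {a b : Equiv.Perm (Fin n)} (hab : a ≠ b)
    {x : Equiv.Perm (Fin n) → ℝ} (hx : x ∈ face {a, b}) : x = edgePt a b (x b) := by
  have hs : x a + x b = 1 := by
    rw [← hx.2.1, ← Finset.sum_pair hab]
    exact Finset.sum_subset (Finset.subset_univ _) fun g _ hg => hx.2.2 g hg
  ext h
  rcases eq_or_ne h a with rfl | ha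
  · simp [edgePt, hab]
    linarith
  rcases eq_or_ne h b with rfl | hb
  · simp [edgePt, ha]
  · simp [edgePt, ha, hb, hx.2.2 h (by simp [ha, hb])]

theorem dimH_skel_one_le (n : ℕ) : dimH (skel n 1) ≤ 1 := by
  have hsub : skel n 1 ⊆ ⋃ p : Equiv.Perm (Fin n) × Equiv.Perm (Fin n),
      Set.range (edgePt p.1 p.2) := by
    intro x hx
    rw [Set.mem_iUnion]
    have hne : ∃ a b : Equiv.Perm (Fin n), x ∈ Set.range (edgePt a b) := by
      have hf := mem_face_support hx
      set T := Finset.univ.filter fun g => x g ≠ 0 with hT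
      have hc : T.card ≤ 2 := hx.2.2
      interval_cases h : T.card
      · rw [Finset.card_eq_zero] at h
        have h1 := hf.2.1
        rw [Finset.sum_eq_zero fun g _ => hf.2.2 g (by simp [h])] at h1
        norm_num at h1
      · obtain ⟨a, ha⟩ := Finset.card_eq_one.1 h
        rw [ha] at hf
        refine ⟨a, a, 0, ?_⟩
        have h1 := hf.2.1
        rw [Finset.sum_eq_single a (fun g _ hg => hf.2.2 g (by simpa using hg)) (by simp)] at h1
        ext g
        by_cases hg : g = a
        · simp [edgePt, hg, h1]
        · simp [edgePt, hg, hf.2.2 g (by simpa using hg)]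
      · obtain ⟨a, b, hab, h2⟩ := Finset.card_eq_two.1 h
        rw [h2] at hf
        exact ⟨a, b, x b, (eq_edgePt hab hf).symm⟩
    obtain ⟨a, b, h⟩ := hne
    exact ⟨(a, b), h⟩
  refine (dimH_mono hsub).trans ?_
  rw [dimH_iUnion]
  refine iSup_le fun p => ?_
  have hc : ContDiff ℝ 1 (edgePt p.1 p.2) := contDiff_pi.2 fun h => by
    unfold edgePt
    fun_prop
  simpa using hc.dimH_range_le

/-! ### Block determinants of admissible maps -/

theorem WeaklyAdmissible.apply_eq_zero {n k : ℕ}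
    {u : (Equiv.Perm (Fin n) → ℝ) → Matrix (Fin n) (Fin n) ℂ} (hu : WeaklyAdmissible n k u)
    {S : Finset (Equiv.Perm (Fin n))} {g : Equiv.Perm (Fin n)} (hg : g ∈ S)
    {x : Equiv.Perm (Fin n) → ℝ} (hx : x ∈ skel n k) (hxS : x ∈ face S) {i j : Fin n}
    (hij : ¬ sameOrbit (groupOf S) i j) : u x (g i) j = 0 := by
  set T := Finset.univ.filter fun g => x g ≠ 0 with hT
  have hTS : T ⊆ S := fun a ha => by
    by_contra h
    exact (Finset.mem_filter.1 ha).2 (hxS.2.2 a h)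
  have hTn : T.Nonempty := by
    rw [Finset.nonempty_iff_ne_empty]
    intro h
    have h1 := hx.2.1
    rw [Finset.sum_eq_zero fun g _ => (mem_face_support hx).2.2 g (by rw [← hT, h]; simp)] at h1
    norm_num at h1
  obtain ⟨a, ha⟩ := hTn
  have h := hu.2.2 T ⟨a, ha⟩ hx.2.2 x hx (mem_face_support hx).2.2 a ha (a⁻¹ (g i)) j
    fun ⟨p, hp, hpj⟩ => hij ⟨p * (a⁻¹ * g),
      mul_mem (groupOf_mono hTS hp) (inv_mul_mem_groupOf (hTS ha) hg), hpj⟩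
  simpa using h

theorem submatrix_perm_mem_unitaryGroup {n : ℕ} {M : Matrix (Fin n) (Fin n) ℂ}
    (hM : M ∈ Matrix.unitaryGroup (Fin n) ℂ) (g : Equiv.Perm (Fin n)) :
    M.submatrix g id ∈ Matrix.unitaryGroup (Fin n) ℂ := by
  rw [Matrix.mem_unitaryGroup_iff] at hM ⊢
  rw [Matrix.star_eq_conjTranspose, Matrix.conjTranspose_submatrix,
    Matrix.submatrix_mul _ _ _ id _ Function.bijective_id |>.symm,
    ← Matrix.star_eq_conjTranspose, hM, Matrix.submatrix_one _ g.injective]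

theorem WeaklyAdmissible.norm_blockDet {n k : ℕ}
    {u : (Equiv.Perm (Fin n) → ℝ) → Matrix (Fin n) (Fin n) ℂ} (hu : WeaklyAdmissible n k u)
    {S : Finset (Equiv.Perm (Fin n))} {g : Equiv.Perm (Fin n)} (hg : g ∈ S)
    {B : Finset (Fin n)} (hB : IsBlock (sameOrbit (groupOf S)) B)
    {x : Equiv.Perm (Fin n) → ℝ} (hx : x ∈ skel n k) (hxS : x ∈ face S) :
    ‖blockDet B ((u x).submatrix g id)‖ = 1 :=
  norm_det_of_mem_unitaryGroup <| hB.submatrix_mem_unitaryGroup (sameOrbit_equivalence _)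
    (submatrix_perm_mem_unitaryGroup (hu.2.1 x hx) g) fun _ _ h => hu.apply_eq_zero hg hx hxS h

theorem continuous_blockDet_submatrix {n : ℕ} (B : Finset (Fin n)) (g : Equiv.Perm (Fin n)) :
    Continuous fun M : Matrix (Fin n) (Fin n) ℂ => blockDet B (M.submatrix g id) := by
  unfold blockDet
  fun_prop

theorem edgePath_eq_submatrix {n : ℕ} (u : (Equiv.Perm (Fin n) → ℝ) → Matrix (Fin n) (Fin n) ℂ)
    (a b : Equiv.Perm (Fin n)) (t : ℝ) :
    edgePath u a b t = (u (edgePt a b t)).submatrix a id :=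
  rfl

/-- Changing the coset representative changes block determinants by a nonzero constant. -/
theorem exists_blockDet_submatrix_eq {n : ℕ} {S : Finset (Equiv.Perm (Fin n))}
    {g h : Equiv.Perm (Fin n)} (hg : g ∈ S) (hh : h ∈ S) {B : Finset (Fin n)}
    (hB : IsBlock (sameOrbit (groupOf S)) B) :
    ∃ c : ℂ, c ≠ 0 ∧ ∀ M : Matrix (Fin n) (Fin n) ℂ,
      blockDet B (M.submatrix h id) = c * blockDet B (M.submatrix g id) := by
  obtain ⟨c, hc, h⟩ := exists_blockDet_permute hB (inv_mul_mem_groupOf hg hh)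
  refine ⟨c, hc, fun M => ?_⟩
  rw [← h]
  congr 1
  ext i j
  simp

theorem Admissible.exists_isLiftOn {n k : ℕ}
    {u : (Equiv.Perm (Fin n) → ℝ) → Matrix (Fin n) (Fin n) ℂ} (hu : Admissible n (k + 1) u)
    {S : Finset (Equiv.Perm (Fin n))} {a b : Equiv.Perm (Fin n)} (ha : a ∈ S) (hb : b ∈ S)
    {B : Finset (Fin n)} (hB : IsBlock (sameOrbit (groupOf S)) B) :
    ∃ l, IsLiftOn (fun t => blockDet B (edgePath u a b t)) l := by
  have hsk : ∀ t ∈ Set.Icc (0 : ℝ) 1, edgePt a b t ∈ skel n (k + 1) := fun t ht =>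
    skel_mono n (by omega) (edgePt_mem_skel a b ht)
  refine _root_.exists_isLiftOn ?_ fun t ht => ?_
  · exact (continuous_blockDet_submatrix B a).comp_continuousOn
      (hu.1.1.comp (continuous_edgePt a b).continuousOn hsk)
  · exact hu.1.norm_blockDet ha hB (hsk t ht) (edgePt_mem_face ha hb ht)

/-! ### Extension to the 2-skeleton -/

/-- The winding numbers around a face over which `u` is defined add up to zero. -/
theorem winding_sum_eq_zero {n : ℕ}
    {u : (Equiv.Perm (Fin n) → ℝ) → Matrix (Fin n) (Fin n) ℂ} (hu : Admissible n 2 u)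
    {S : Finset (Equiv.Perm (Fin n))} (hS : S.card ≤ 3) {g0 g1 g2 : Equiv.Perm (Fin n)}
    (h0 : g0 ∈ S) (h1 : g1 ∈ S) (h2 : g2 ∈ S) {B : Finset (Fin n)}
    (hB : IsBlock (sameOrbit (groupOf S)) B) {l01 l12 l02 : ℝ → ℝ}
    (hl01 : IsLiftOn (fun t => blockDet B (edgePath u g0 g1 t)) l01)
    (hl12 : IsLiftOn (fun t => blockDet B (edgePath u g1 g2 t)) l12)
    (hl02 : IsLiftOn (fun t => blockDet B (edgePath u g0 g2 t)) l02) :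
    (l01 1 - l01 0) + (l12 1 - l12 0) - (l02 1 - l02 0) = 0 := by
  let D : (Equiv.Perm (Fin n) → ℝ) → ℂ := fun x => blockDet B ((u x).submatrix g0 id)
  let P : ℝ → ℝ := fun s => Set.projIcc (0 : ℝ) 1 zero_le_one s
  have hPI : ∀ s, P s ∈ Set.Icc (0 : ℝ) 1 := fun s => (Set.projIcc (0 : ℝ) 1 zero_le_one s).2
  have hPc : Continuous P := by fun_prop
  have hP : ∀ s ∈ Set.Icc (0 : ℝ) 1, P s = s := fun s hs => by
    simp [P, Set.projIcc_of_mem zero_le_one hs]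
  have hP0 : P 0 = 0 := hP 0 (by simp)
  have hP1 : P 1 = 1 := hP 1 (by simp)
  let φ : ℝ × ℝ → Equiv.Perm (Fin n) → ℝ := fun p h =>
    (1 - P p.1) * edgePt g0 g1 (P p.2) h + P p.1 * vertex g2 h
  have hφc : Continuous φ := continuous_pi fun h => by
    simp only [φ, edgePt]
    fun_prop
  have hφS : ∀ p, φ p ∈ face S := by
    intro p
    have he := edgePt_mem_face h0 h1 (hPI p.2)
    have hv : vertex g2 ∈ face S :=
      ⟨fun g => by unfold vertex; positivity, by simp [vertex], fun g hg => by
        simp [vertex, show g ≠ g2 from fun h => hg (h ▸ h2)]⟩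
    refine ⟨fun g => ?_, ?_, fun g hg => ?_⟩
    · exact add_nonneg (mul_nonneg (sub_nonneg.2 (hPI _).2) (he.1 g))
        (mul_nonneg (hPI _).1 (hv.1 g))
    · simp only [φ, Finset.sum_add_distrib, ← Finset.mul_sum, he.2.1, hv.2.1]
      ring
    · simp [φ, he.2.2 g hg, hv.2.2 g hg]
  have hφk : ∀ p, φ p ∈ skel n 2 := fun p => mem_skel_of_mem_face hS (hφS p)
  have hDc : Continuous fun p => D (φ p) :=
    (continuous_blockDet_submatrix B g0).comp (hu.1.1.comp_continuous hφc hφk)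
  obtain ⟨Λ, hΛc, hΛ⟩ := exists_continuous_exp_eq hDc fun p hp => by
    have := hu.1.norm_blockDet h0 hB (hφk p) (hφS p)
    simp [show blockDet B ((u (φ p)).submatrix g0 id) = 0 from hp] at this
  have hφ01 : ∀ t ∈ Set.Icc (0 : ℝ) 1, φ (0, t) = edgePt g0 g1 t := fun t ht => by
    ext h
    simp [φ, hP0, hP t ht]
  have hφ02 : ∀ t ∈ Set.Icc (0 : ℝ) 1, φ (t, 0) = edgePt g0 g2 t := fun t ht => by
    ext h
    simp [φ, hP0, hP t ht, edgePt, vertex]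
  have hφ12 : ∀ t ∈ Set.Icc (0 : ℝ) 1, φ (t, 1) = edgePt g1 g2 t := fun t ht => by
    ext h
    simp [φ, hP1, hP t ht, edgePt, vertex]
  have hφ2 : ∀ t, φ (1, t) = φ (1, 0) := fun t => by
    ext h
    simp [φ, hP1]
  have hlc : ∀ {f l}, IsLiftOn f l →
      ContinuousOn (fun t => 2 * Real.pi * Complex.I * (l t : ℂ)) (Set.Icc 0 1) := fun h =>
    continuousOn_const.mul (Complex.continuous_ofReal.comp_continuousOn h.1)
  obtain ⟨c, -, hc⟩ := exists_blockDet_submatrix_eq h0 h1 hB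
  have e01 := sub_eq_sub_of_exp_eq_mul_exp (hlc hl01) (g := fun t => Λ (0, t)) (c := 1)
    (by fun_prop) fun t ht => by
      rw [← hl01.2 t ht, hΛ, hφ01 t ht, one_mul]
      rfl
  have e02 := sub_eq_sub_of_exp_eq_mul_exp (hlc hl02) (g := fun t => Λ (t, 0)) (c := 1)
    (by fun_prop) fun t ht => by
      rw [← hl02.2 t ht, hΛ, hφ02 t ht, one_mul]
      rfl
  have e12 := sub_eq_sub_of_exp_eq_mul_exp (hlc hl12) (g := fun t => Λ (t, 1)) (c := c)
    (by fun_prop) fun t ht => by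
      rw [← hl12.2 t ht, hΛ, hφ12 t ht]
      exact hc _
  have e2 := sub_eq_sub_of_exp_eq_mul_exp (f := fun t => Λ (1, t)) (g := fun _ => Λ (1, 0))
    (c := 1) (by fun_prop) (by fun_prop) fun t _ => by rw [hΛ, hΛ, hφ2, one_mul]
  have h : 2 * Real.pi * Complex.I *
      (((l01 1 - l01 0) + (l12 1 - l12 0) - (l02 1 - l02 0) : ℝ) : ℂ) = 0 := by
    push_cast
    linear_combination e01 + e12 - e02 + e2
  exact_mod_cast (mul_eq_zero.1 h).resolve_left Complex.two_pi_I_ne_zero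

/-- If the winding numbers around a face add up to zero, the block determinants have a continuous
logarithm on the boundary of the face. -/
theorem exists_log_blockDet {n : ℕ}
    {u : (Equiv.Perm (Fin n) → ℝ) → Matrix (Fin n) (Fin n) ℂ}
    {S : Finset (Equiv.Perm (Fin n))} {g0 g1 g2 : Equiv.Perm (Fin n)}
    (hS : ∀ g, g ∈ S ↔ g = g0 ∨ g = g1 ∨ g = g2) (h01 : g0 ≠ g1) (h12 : g1 ≠ g2) (h02 : g0 ≠ g2)
    {B : Finset (Fin n)} (hB : IsBlock (sameOrbit (groupOf S)) B) {l01 l12 l02 : ℝ → ℝ}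
    (hl01 : IsLiftOn (fun t => blockDet B (edgePath u g0 g1 t)) l01)
    (hl12 : IsLiftOn (fun t => blockDet B (edgePath u g1 g2 t)) l12)
    (hl02 : IsLiftOn (fun t => blockDet B (edgePath u g0 g2 t)) l02)
    (hw : (l01 1 - l01 0) + (l12 1 - l12 0) - (l02 1 - l02 0) = 0) :
    ∃ θ : (Equiv.Perm (Fin n) → ℝ) → ℂ, ContinuousOn θ (face S ∩ skel n 1) ∧
      ∀ x ∈ face S ∩ skel n 1, blockDet B ((u x).submatrix g0 id) = Complex.exp (θ x) := by
  let D : (Equiv.Perm (Fin n) → ℝ) → ℂ := fun x => blockDet B ((u x).submatrix g0 id)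
  let z : ℝ → ℂ := fun r => 2 * Real.pi * Complex.I * r
  have hzc : Continuous z := by fun_prop
  let θ : (Equiv.Perm (Fin n) → ℝ) → ℂ := fun x =>
    if x g2 = 0 then z (l01 (x g1))
    else if x g0 = 0 then z (l01 1 - l12 0 + l12 (x g2))
    else z (l01 0 - l02 0 + l02 (x g2))
  have hsum : ∀ x ∈ face S, x g0 + x g1 + x g2 = 1 := fun x hx => by
    have hc : ({g0, g1, g2} : Finset (Equiv.Perm (Fin n))) = S := by
      ext g
      simp [hS]
    rw [← hx.2.1, ← Finset.sum_subset S.subset_univ fun g _ hg => hx.2.2 g hg, ← hc,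
      Finset.sum_insert (by simp [h01, h02]), Finset.sum_pair h12, add_assoc]
  have hI : ∀ x ∈ face S, ∀ g, x g ∈ Set.Icc (0 : ℝ) 1 := fun x hx g =>
    ⟨hx.1 g, by rw [← hx.2.1]; exact Finset.single_le_sum (fun g _ => hx.1 g) (Finset.mem_univ g)⟩
  have hedge : ∀ {a b}, a ≠ b → ∀ x ∈ face S, (∀ g ∈ S, g ≠ a → g ≠ b → x g = 0) →
      x = edgePt a b (x b) := fun hab x hx h =>
    eq_edgePt hab ⟨hx.1, hx.2.1, fun g hg => by
      by_cases hgS : g ∈ S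
      · exact h g hgS (fun e => hg (by simp [e])) fun e => hg (by simp [e])
      · exact hx.2.2 g hgS⟩
  have hx01 : ∀ x ∈ face S, x g2 = 0 → x = edgePt g0 g1 (x g1) := fun x hx h =>
    hedge h01 x hx fun g hg ha hb => by
      rcases (hS g).1 hg with rfl | rfl | rfl <;> first | exact h | contradiction
  have hx12 : ∀ x ∈ face S, x g0 = 0 → x = edgePt g1 g2 (x g2) := fun x hx h =>
    hedge h12 x hx fun g hg ha hb => by
      rcases (hS g).1 hg with rfl | rfl | rfl <;> first | exact h | contradiction
  have hx02 : ∀ x ∈ face S, x g1 = 0 → x = edgePt g0 g2 (x g2) := fun x hx h =>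
    hedge h02 x hx fun g hg ha hb => by
      rcases (hS g).1 hg with rfl | rfl | rfl <;> first | exact h | contradiction
  have hθ01 : ∀ x ∈ face S, x g2 = 0 → θ x = z (l01 (x g1)) := fun x _ h => by simp [θ, h]
  have hθ12 : ∀ x ∈ face S, x g0 = 0 → θ x = z (l01 1 - l12 0 + l12 (x g2)) := fun x hx h => by
    by_cases h2 : x g2 = 0
    · have h1 : x g1 = 1 := by linarith [hsum x hx]
      simp [θ, h2, h1]
    · simp [θ, h2, h]
  have hθ02 : ∀ x ∈ face S, x g1 = 0 → θ x = z (l01 0 - l02 0 + l02 (x g2)) := fun x hx h => by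
    by_cases h2 : x g2 = 0
    · simp [θ, h2, h]
    · by_cases h0 : x g0 = 0
      · have h1 : x g2 = 1 := by linarith [hsum x hx]
        simp only [θ, h0, h1, if_true, one_ne_zero, if_false]
        congr 1
        linarith
      · simp [θ, h2, h0]
  have hY : face S ∩ skel n 1 ⊆ {x ∈ face S | x g2 = 0} ∪ {x ∈ face S | x g0 = 0} ∪
      {x ∈ face S | x g1 = 0} := by
    rintro x ⟨hx, hk⟩
    by_contra hn
    simp only [Set.mem_union, Set.mem_ofPred_eq, hx, true_and, not_or] at hn
    have hc : ({g0, g1, g2} : Finset (Equiv.Perm (Fin n))).card = 3 :=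
      Finset.card_eq_three.2 ⟨g0, g1, g2, h01, h02, h12, rfl⟩
    have hle := (Finset.card_le_card (s := {g0, g1, g2})
      (t := Finset.univ.filter fun g => x g ≠ 0) (by
        intro g hg
        simp only [Finset.mem_insert, Finset.mem_singleton] at hg
        rcases hg with rfl | rfl | rfl <;> simp [hn])).trans hk.2.2
    omega
  have hcl : ∀ g, IsClosed {x ∈ face S | x g = 0} := fun g =>
    (isClosed_face S).inter (isClosed_eq (continuous_apply g) continuous_const)
  have hcont : ∀ g {l : ℝ → ℝ} (r : ℝ), ContinuousOn l (Set.Icc 0 1) →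
      ContinuousOn (fun x : Equiv.Perm (Fin n) → ℝ => z (r + l (x g))) (face S) :=
    fun g l r hl => hzc.comp_continuousOn (continuousOn_const.add
      (hl.comp (continuous_apply g).continuousOn fun x hx => hI x hx g))
  refine ⟨θ, ContinuousOn.mono ?_ hY, fun x hx => ?_⟩
  · refine ContinuousOn.union_of_isClosed (ContinuousOn.union_of_isClosed ?_ ?_ (hcl _) (hcl _))
      ?_ ((hcl _).union (hcl _)) (hcl _)
    · exact ((hcont g1 0 hl01.1).mono fun _ h => h.1).congr fun x hx => by
        simp only [hθ01 x hx.1 hx.2, zero_add]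
    · exact ((hcont g2 _ hl12.1).mono fun _ h => h.1).congr fun x hx => hθ12 x hx.1 hx.2
    · exact ((hcont g2 _ hl02.1).mono fun _ h => h.1).congr fun x hx => hθ02 x hx.1 hx.2
  · have hD01 : ∀ t ∈ Set.Icc (0 : ℝ) 1, D (edgePt g0 g1 t) = Complex.exp (z (l01 t)) := hl01.2
    have hD02 : ∀ t ∈ Set.Icc (0 : ℝ) 1, D (edgePt g0 g2 t) = Complex.exp (z (l02 t)) := hl02.2
    have zadd : ∀ a b, z (a + b) = z a + z b := fun a b => by
      simp only [z, Complex.ofReal_add]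
      ring
    have zsub : ∀ a b, z (a - b) = z a - z b := fun a b => by
      simp only [z, Complex.ofReal_sub]
      ring
    have m0 : (0 : ℝ) ∈ Set.Icc (0 : ℝ) 1 := by simp
    have m1 : (1 : ℝ) ∈ Set.Icc (0 : ℝ) 1 := by simp
    change D x = _
    rcases hY hx with (h | h) | h
    · rw [hθ01 x h.1 h.2, ← hD01 _ (hI x h.1 _), ← hx01 x h.1 h.2]
    · obtain ⟨c, hc0, hc⟩ := exists_blockDet_submatrix_eq ((hS g0).2 (by simp))
        ((hS g1).2 (by simp)) hB
      have hD12 : ∀ t ∈ Set.Icc (0 : ℝ) 1, c * D (edgePt g1 g2 t) = Complex.exp (z (l12 t)) :=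
        fun t ht => (hc _).symm.trans (hl12.2 t ht)
      have he : edgePt g0 g1 1 = edgePt g1 g2 0 := by
        ext
        simp [edgePt]
      have hne : D (edgePt g1 g2 0) ≠ 0 := by
        rw [← he, hD01 1 m1]
        exact Complex.exp_ne_zero _
      rw [hθ12 x h.1 h.2, zadd, zsub, Complex.exp_add, Complex.exp_sub, ← hD01 1 m1,
        ← hD12 0 m0, ← hD12 _ (hI x h.1 _), ← hx12 x h.1 h.2, he]
      field_simp
    · have he : edgePt g0 g1 0 = edgePt g0 g2 0 := by
        ext
        simp [edgePt]
      have hne : D (edgePt g0 g2 0) ≠ 0 := by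
        rw [hD02 0 m0]
        exact Complex.exp_ne_zero _
      rw [hθ02 x h.1 h.2, zadd, zsub, Complex.exp_add, Complex.exp_sub, ← hD01 0 m0,
        ← hD02 0 m0, ← hD02 _ (hI x h.1 _), ← hx02 x h.1 h.2, he]
      field_simp

theorem exists_extension_on_face {n : ℕ}
    {u : (Equiv.Perm (Fin n) → ℝ) → Matrix (Fin n) (Fin n) ℂ} (hu : Admissible n 1 u)
    {S : Finset (Equiv.Perm (Fin n))} {g0 g1 g2 : Equiv.Perm (Fin n)}
    (hS : ∀ g, g ∈ S ↔ g = g0 ∨ g = g1 ∨ g = g2) (h01 : g0 ≠ g1) (h12 : g1 ≠ g2) (h02 : g0 ≠ g2)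
    (hw : ∀ B : Finset (Fin n), IsBlock (sameOrbit (groupOf S)) B → ∀ l01 l12 l02 : ℝ → ℝ,
      IsLiftOn (fun t => blockDet B (edgePath u g0 g1 t)) l01 →
      IsLiftOn (fun t => blockDet B (edgePath u g1 g2 t)) l12 →
      IsLiftOn (fun t => blockDet B (edgePath u g0 g2 t)) l02 →
      (l01 1 - l01 0) + (l12 1 - l12 0) - (l02 1 - l02 0) = 0) :
    ∃ V : (Equiv.Perm (Fin n) → ℝ) → Matrix (Fin n) (Fin n) ℂ, Continuous V ∧
      (∀ x, V x ∈ Matrix.unitaryGroup (Fin n) ℂ) ∧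
      (∀ x, ∀ g ∈ S, ∀ i j, ¬ sameOrbit (groupOf S) i j → V x (g i) j = 0) ∧
      ∀ x ∈ face S ∩ skel n 1, V x = u x := by
  have m0 : g0 ∈ S := (hS g0).2 (by simp)
  have m1 : g1 ∈ S := (hS g1).2 (by simp)
  have m2 : g2 ∈ S := (hS g2).2 (by simp)
  have hr := sameOrbit_equivalence (groupOf S)
  have hdim : dimH (face S ∩ skel n 1) < 2 :=
    ((dimH_mono Set.inter_subset_right).trans (dimH_skel_one_le n)).trans_lt (by norm_num)
  obtain ⟨N, hNc, hNU, hN0, hN⟩ := exists_blockDiagonal_unitary_extension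
    ((isCompact_face S).inter_right (isClosed_skel n 1)) hdim hr (fun x => (u x).submatrix g0 id)
    ((continuous_id.matrix_submatrix _ _).comp_continuousOn (hu.1.1.mono Set.inter_subset_right))
    (fun x hx => submatrix_perm_mem_unitaryGroup (hu.1.2.1 x hx.2) g0)
    (fun x hx i j h => hu.1.apply_eq_zero m0 hx.2 hx.1 h)
    (fun B hB => by
      obtain ⟨l01, hl01⟩ := hu.exists_isLiftOn m0 m1 hB
      obtain ⟨l12, hl12⟩ := hu.exists_isLiftOn m1 m2 hB
      obtain ⟨l02, hl02⟩ := hu.exists_isLiftOn m0 m2 hB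
      exact exists_log_blockDet hS h01 h12 h02 hB hl01 hl12 hl02
        (hw B hB l01 l12 l02 hl01 hl12 hl02))
  refine ⟨fun x => (N x).submatrix (g0⁻¹ : Equiv.Perm (Fin n)) id, hNc.matrix_submatrix _ _,
    fun x => submatrix_perm_mem_unitaryGroup (hNU x) _, fun x g hg i j h => ?_, fun x hx => ?_⟩
  · exact hN0 x _ j fun h' => h (hr.trans ⟨g0⁻¹ * g, inv_mul_mem_groupOf m0 hg, rfl⟩ h')
  · simp only [hN x hx]
    ext i j
    simp

/-- Extensions over the individual 2-faces glue to an extension to the 2-skeleton. -/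
theorem exists_admissible_extension {n : ℕ}
    {u : (Equiv.Perm (Fin n) → ℝ) → Matrix (Fin n) (Fin n) ℂ} (hu : Admissible n 1 u)
    (hV : ∀ S : Finset (Equiv.Perm (Fin n)), S.card = 3 →
      ∃ V : (Equiv.Perm (Fin n) → ℝ) → Matrix (Fin n) (Fin n) ℂ, Continuous V ∧
        (∀ x, V x ∈ Matrix.unitaryGroup (Fin n) ℂ) ∧
        (∀ x, ∀ g ∈ S, ∀ i j, ¬ sameOrbit (groupOf S) i j → V x (g i) j = 0) ∧
        ∀ x ∈ face S ∩ skel n 1, V x = u x) :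
    ∃ u', Admissible n 2 u' ∧ ∀ x ∈ skel n 1, u' x = u x := by
  classical
  have hV' : ∀ S : Finset (Equiv.Perm (Fin n)),
      ∃ V : (Equiv.Perm (Fin n) → ℝ) → Matrix (Fin n) (Fin n) ℂ, S.card = 3 → Continuous V ∧
        (∀ x, V x ∈ Matrix.unitaryGroup (Fin n) ℂ) ∧
        (∀ x, ∀ g ∈ S, ∀ i j, ¬ sameOrbit (groupOf S) i j → V x (g i) j = 0) ∧
        ∀ x ∈ face S ∩ skel n 1, V x = u x := fun S => by
    by_cases h : S.card = 3
    · obtain ⟨V, hV⟩ := hV S h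
      exact ⟨V, fun _ => hV⟩
    · exact ⟨fun _ => 0, fun h' => absurd h' h⟩
  choose V hV using hV'
  let supp : (Equiv.Perm (Fin n) → ℝ) → Finset (Equiv.Perm (Fin n)) := fun x =>
    Finset.univ.filter fun g => x g ≠ 0
  have hsupp : ∀ {S x}, x ∈ face S → supp x ⊆ S := fun {S x} hx g hg => by
    by_contra h
    exact (Finset.mem_filter.1 hg).2 (hx.2.2 g h)
  let w : (Equiv.Perm (Fin n) → ℝ) → Matrix (Fin n) (Fin n) ℂ := fun x =>
    if x ∈ skel n 1 then u x else V (supp x) x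
  have hw1 : ∀ x ∈ skel n 1, w x = u x := fun x hx => if_pos hx
  have hcard : ∀ x ∈ skel n 2, x ∉ skel n 1 → (supp x).card = 3 := fun x hx h => by
    have h2 : (supp x).card ≤ 3 := hx.2.2
    have h1 : ¬ (supp x).card ≤ 2 := fun h' => h ⟨hx.1, hx.2.1, h'⟩
    omega
  have hw3 : ∀ S : Finset (Equiv.Perm (Fin n)), S.card = 3 → ∀ x ∈ face S, w x = V S x := by
    intro S hS x hx
    by_cases h : x ∈ skel n 1
    · rw [hw1 x h, (hV S hS).2.2.2 x ⟨hx, h⟩]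
    · have hs : supp x = S := Finset.eq_of_subset_of_card_le (hsupp hx)
        (by rw [hcard x (mem_skel_of_mem_face hS.le hx) h, hS])
      simp only [w, if_neg h, hs]
  refine ⟨w, ⟨⟨?_, fun x hx => ?_, fun S _ _ x hx hxS g hg i j hij => ?_⟩, fun g => ?_⟩, hw1⟩
  · rw [skel_eq_iUnion_face]
    refine (locallyFinite_of_finite _).continuousOn_iUnion (fun S => isClosed_face S.1) ?_
    rintro ⟨S, hS⟩
    rcases hS.lt_or_eq with h | h
    · have hsk : face S ⊆ skel n 1 := fun x hx => mem_skel_of_mem_face (by omega) hx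
      exact (hu.1.1.mono hsk).congr fun x hx => hw1 x (hsk hx)
    · exact (hV S h).1.continuousOn.congr fun x hx => hw3 S h x hx
  · by_cases h : x ∈ skel n 1
    · exact hw1 x h ▸ hu.1.2.1 x h
    · simpa only [w, if_neg h] using (hV _ (hcard x hx h)).2.1 x
  · have hf : x ∈ face S := ⟨hx.1, hx.2.1, hxS⟩
    by_cases h : x ∈ skel n 1
    · rw [hw1 x h]
      exact hu.1.apply_eq_zero hg h hf hij
    · have hc := hcard x hx h
      have hs : supp x = S := Finset.eq_of_subset_of_card_le (hsupp hf) (by omega)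
      rw [hw3 S (hs ▸ hc) x hf]
      exact (hV S (hs ▸ hc)).2.2.1 x g hg i j hij
  · rw [hw1 _ ?_, hu.2 g]
    refine mem_skel_of_mem_face (S := {g}) (by simp) ⟨fun h => ?_, ?_, fun h hh => ?_⟩
    · unfold vertex
      positivity
    · simp [vertex]
    · simpa [vertex] using hh

/-- an admissible map on the 1-skeleton of `Δ^{S_n}` extends to an
admissible map on the 2-skeleton iff for every 2-face `g₀ < g₁ < g₂` and every block `B`
of `𝒫(Δ^{g₀,g₁,g₂})` the winding numbers of the edge paths satisfy
`w_B(γ^{g₀,g₁}) + w_B(γ^{g₁,g₂}) - w_B(γ^{g₀,g₂}) = 0`. -/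
theorem admissible_extends_iff_winding_sum_zero {n : ℕ}
    [LinearOrder (Equiv.Perm (Fin n))]
    (u : (Equiv.Perm (Fin n) → ℝ) → Matrix (Fin n) (Fin n) ℂ)
    (hu : Admissible n 1 u) :
    (∃ u', Admissible n 2 u' ∧ ∀ x ∈ skel n 1, u' x = u x) ↔
    ∀ g0 g1 g2 : Equiv.Perm (Fin n), g0 < g1 → g1 < g2 →
      ∀ B : Finset (Fin n), IsBlock (sameOrbit (groupOf {g0, g1, g2})) B →
        ∀ l01 l12 l02 : ℝ → ℝ,
          IsLiftOn (fun t => blockDet B (edgePath u g0 g1 t)) l01 →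
          IsLiftOn (fun t => blockDet B (edgePath u g1 g2 t)) l12 →
          IsLiftOn (fun t => blockDet B (edgePath u g0 g2 t)) l02 →
          (l01 1 - l01 0) + (l12 1 - l12 0) - (l02 1 - l02 0) = 0 := by
  constructor
  · rintro ⟨u', hu', huu'⟩ g0 g1 g2 h01 h12 B hB l01 l12 l02 hl01 hl12 hl02
    have hlift : ∀ {a b l}, IsLiftOn (fun t => blockDet B (edgePath u a b t)) l →
        IsLiftOn (fun t => blockDet B (edgePath u' a b t)) l := fun h =>
      ⟨h.1, fun t ht => by
        simp only [← h.2 t ht, edgePath_eq_submatrix, huu' _ (edgePt_mem_skel _ _ ht)]⟩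
    exact winding_sum_eq_zero hu' Finset.card_le_three (by simp) (by simp) (by simp) hB
      (hlift hl01) (hlift hl12) (hlift hl02)
  · intro hw
    refine exists_admissible_extension hu fun S hS => ?_
    let e := S.orderEmbOfFin hS
    have he : ∀ g, g ∈ S ↔ g = e 0 ∨ g = e 1 ∨ g = e 2 := fun g => by
      rw [← Finset.mem_coe, ← Finset.range_orderEmbOfFin S hS, Set.mem_range, Fin.exists_fin_succ,
        Fin.exists_fin_two, eq_comm (b := g), eq_comm (b := g), eq_comm (b := g)]
      rfl
    have h01 : e 0 < e 1 := e.lt_iff_lt.2 (by decide)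
    have h12 : e 1 < e 2 := e.lt_iff_lt.2 (by decide)
    refine exists_extension_on_face hu he h01.ne h12.ne (h01.trans h12).ne fun B hB => ?_
    refine hw _ _ _ h01 h12 B ?_
    convert hB
    ext g
    simp [he]
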